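/- Let $L \subseteq \overline{\mathbb{Q}}$ be a number field and $\mu : J_L \to \mathbb{Z}$. Let $H = \{\tau \in G_{\mathbb{Q}} : \tau\mu = \mu\}$ be the stabilizer of $\mu$ (a closed subgroup of $G_{\mathbb{Q}}$). Then the fixed field $\overline{\mathbb{Q}}^{H}$ equals the subfield of $\overline{\mathbb{Q}}$ generated over $\mathbb{Q}$ by the elements $x^{\mu} = \prod_{\sigma \in J_L} \sigma(x)^{\mu(\sigma)}$ for $x \in L^{\times}$. -/

import Mathlib

/-!
STATEMENT 11: Let `L ⊆ ℚ̄` be a number field and `μ : J_L → ℤ`.  Let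
`H = {τ ∈ G_ℚ : τμ = μ}` be the stabilizer of `μ`.  Then the fixed field `ℚ̄^H`
equals the subfield of `ℚ̄` generated over `ℚ` by the elements
`x^μ = ∏_σ σ(x)^{μ σ}` for `x ∈ L^×`.

Here `ℚ̄` is the algebraic closure of `ℚ` (abstractly, any `IsAlgClosure ℚ Qbar`;
it embeds into `ℂ` with image the algebraic numbers), `J_L` is the set of embeddings
`L ↪ ℚ̄`, and `G_ℚ = Gal(ℚ̄/ℚ)` acts on `J_L` by composition and on functions
`μ : J_L → ℤ` by `(τμ)(σ) = μ(τ⁻¹ ∘ σ)`.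
-/

variable {Qbar : Type*} [Field Qbar] [Algebra ℚ Qbar]

/-- the action of `Gal(ℚ̄/ℚ)` on embeddings `L ↪ ℚ̄`, by composition -/
def gact {L : IntermediateField ℚ Qbar} (τ : Qbar ≃ₐ[ℚ] Qbar) (σ : ↥L →+* Qbar) :
    ↥L →+* Qbar :=
  (τ : Qbar →ₐ[ℚ] Qbar).toRingHom.comp σ

lemma gact_gact {L : IntermediateField ℚ Qbar} (τ₁ τ₂ : Qbar ≃ₐ[ℚ] Qbar)
    (σ : ↥L →+* Qbar) : gact τ₁ (gact τ₂ σ) = gact (τ₁ * τ₂) σ := rfl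

lemma gact_one {L : IntermediateField ℚ Qbar} (σ : ↥L →+* Qbar) : gact 1 σ = σ := rfl

/-- the stabilizer `{τ ∈ G_ℚ : τμ = μ}` of `μ : J_L → ℤ`, where `(τμ)(σ) = μ(τ⁻¹ ∘ σ)` -/
def stab {L : IntermediateField ℚ Qbar} (μ : (↥L →+* Qbar) → ℤ) :
    Subgroup (Qbar ≃ₐ[ℚ] Qbar) where
  carrier := {τ | ∀ σ, μ (gact τ⁻¹ σ) = μ σ}
  one_mem' := by intro σ; rw [inv_one, gact_one]
  mul_mem' := by
    intro a b ha hb σ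
    have : gact (a * b)⁻¹ σ = gact b⁻¹ (gact a⁻¹ σ) := by
      rw [gact_gact, mul_inv_rev]
    rw [this, hb, ha]
  inv_mem' := by
    intro a ha σ
    have := ha (gact a⁻¹⁻¹ σ)
    rw [gact_gact, mul_inv_cancel, gact_one] at this
    exact this.symm

open Polynomial in
/-- Distinct embeddings of a number field are multiplicatively independent. -/
lemma eq_zero_of_prod_embeddings_zpow_eq_one {L K : Type*} [Field L] [NumberField L]
    [Field K] [CharZero K] [Fintype (L →+* K)] (ν : (L →+* K) → ℤ)
    (h : ∀ x : L, x ≠ 0 → ∏ σ : L →+* K, σ x ^ ν σ = 1) : ν = 0 := by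
  suffices key : ∀ ν : (L →+* K) → ℤ,
      (∀ x : L, x ≠ 0 → ∏ σ : L →+* K, σ x ^ ν σ = 1) → ∀ σ, ν σ ≤ 0 by
    funext σ
    refine le_antisymm (key ν h σ) ?_
    have := key (-ν) (fun x hx => by simp [h x hx]) σ
    simpa using this
  clear h ν
  intro ν h σ₀
  by_contra! hpos
  let α : L := (Field.powerBasisOfFiniteOfSeparable ℚ L).gen
  have hα : ∀ σ : L →+* K, σ α = σ₀ α → σ = σ₀ := by
    intro σ hσ
    have : σ.toRatAlgHom = σ₀.toRatAlgHom :=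
      (Field.powerBasisOfFiniteOfSeparable ℚ L).algHom_ext hσ
    ext x
    exact DFunLike.congr_fun this x
  let P (ν : (L →+* K) → ℤ) : K[X] := ∏ σ : L →+* K, (X - C (σ α)) ^ (ν σ).toNat
  have hPQ : P ν = P (-ν) := by
    refine eq_of_infinite_eval_eq _ _ (Set.Infinite.mono (s := (fun n : ℕ => (n : K)) ''
      {n : ℕ | (n : L) ≠ α}) ?_ (Set.Infinite.image Nat.cast_injective.injOn ?_))
    · rintro _ ⟨n, hn, rfl⟩
      have hx : (n : L) - α ≠ 0 := sub_ne_zero.mpr hn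
      have hprod := h _ hx
      have hne : ∀ σ : L →+* K, (n : K) - σ α ≠ 0 := fun σ => by
        simpa using (map_ne_zero σ).mpr hx
      have hsplit : ∀ σ : L →+* K, σ (n - α) ^ ν σ =
          ((n : K) - σ α) ^ (ν σ).toNat / ((n : K) - σ α) ^ (-ν σ).toNat := by
        intro σ
        rw [map_sub, map_natCast, ← zpow_natCast, ← zpow_natCast, ← zpow_sub₀ (hne σ)]
        congr 1
        omega
      simp only [hsplit, Finset.prod_div_distrib] at hprod
      have := eq_of_div_eq_one hprod
      simpa [P, eval_prod] using this
    · refine Set.Finite.infinite_compl (s := {n : ℕ | (n : L) = α}) ?_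
      exact Set.Subsingleton.finite fun a ha b hb =>
        Nat.cast_injective (R := L) (Eq.trans ha (Eq.symm hb))
  have hroot : (P ν).eval (σ₀ α) = 0 := by
    simp only [P, eval_prod]
    refine Finset.prod_eq_zero (Finset.mem_univ σ₀) ?_
    simpa using hpos
  rw [hPQ] at hroot
  simp only [P, eval_prod] at hroot
  obtain ⟨σ, -, hσ⟩ := Finset.prod_eq_zero_iff.mp hroot
  rw [eval_pow, eval_sub, eval_X, eval_C, pow_eq_zero_iff', sub_eq_zero] at hσ
  obtain rfl := hα σ hσ.1.symm
  exact hσ.2 (by simpa using hpos.le)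

/-- `τ (x ^ μ) = x ^ (τ μ)`. -/
lemma map_prod_embeddings_zpow {L : IntermediateField ℚ Qbar} [Fintype (↥L →+* Qbar)]
    (μ : (↥L →+* Qbar) → ℤ) (τ : Qbar ≃ₐ[ℚ] Qbar) (x : L) :
    τ (∏ σ : ↥L →+* Qbar, σ x ^ μ σ) = ∏ σ : ↥L →+* Qbar, σ x ^ μ (gact τ⁻¹ σ) := by
  rw [map_prod]
  refine Fintype.prod_equiv ⟨gact τ, gact τ⁻¹, fun σ => ?_, fun σ => ?_⟩ _ _ fun σ => ?_
  · rw [gact_gact, inv_mul_cancel, gact_one]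
  · rw [gact_gact, mul_inv_cancel, gact_one]
  · rw [Equiv.coe_fn_mk, gact_gact, inv_mul_cancel, gact_one, map_zpow₀]
    rfl

theorem statement11
    (Qbar : Type*) [Field Qbar] [Algebra ℚ Qbar] [IsAlgClosure ℚ Qbar]
    (L : IntermediateField ℚ Qbar) [FiniteDimensional ℚ L]
    [Fintype (↥L →+* Qbar)]
    (μ : (↥L →+* Qbar) → ℤ) :
    IntermediateField.fixedField (stab μ) =
      IntermediateField.adjoin ℚ
        {y : Qbar | ∃ x : ↥L, x ≠ 0 ∧ y = ∏ σ : ↥L →+* Qbar, σ x ^ μ σ} := by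
  have : CharZero Qbar := algebraRat.charZero Qbar
  have : CharZero L := algebraRat.charZero L
  have : NumberField L :=
    { to_finiteDimensional := by
        convert ‹FiniteDimensional ℚ L›
        exact Subsingleton.elim _ _ }
  have : IsGalois ℚ Qbar := IsAlgClosure.isGalois ℚ Qbar
  apply le_antisymm
  · rw [← InfiniteGalois.fixedField_fixingSubgroup (IntermediateField.adjoin ℚ
        {y : Qbar | ∃ x : ↥L, x ≠ 0 ∧ y = ∏ σ : ↥L →+* Qbar, σ x ^ μ σ})]
    refine IntermediateField.fixedField_antitone fun τ hτ => ?_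
    rw [IntermediateField.mem_fixingSubgroup_iff] at hτ
    have hν := eq_zero_of_prod_embeddings_zpow_eq_one
      (fun σ : ↥L →+* Qbar => μ (gact τ⁻¹ σ) - μ σ) fun x hx => by
        have hne : ∀ σ : ↥L →+* Qbar, σ x ≠ 0 := fun σ => (map_ne_zero σ).mpr hx
        have hfix := hτ _ (IntermediateField.subset_adjoin _ _ ⟨x, hx, rfl⟩)
        rw [map_prod_embeddings_zpow] at hfix
        simp only [zpow_sub₀ (hne _), Finset.prod_div_distrib, hfix]
        exact div_self (Finset.prod_ne_zero_iff.mpr fun σ _ => zpow_ne_zero _ (hne σ))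
    exact fun σ => sub_eq_zero.mp (congr_fun hν σ)
  · rw [IntermediateField.adjoin_le_iff]
    rintro _ ⟨x, -, rfl⟩
    rw [SetLike.mem_coe, IntermediateField.mem_fixedField_iff]
    intro τ hτ
    rw [map_prod_embeddings_zpow]
    exact Finset.prod_congr rfl fun σ _ => by rw [hτ σ]
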